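/- Let u = (u_1,…,u_N) : ℝ^d × [0,T) → ℝ^N be a classical solution of the Allen–Cahn system (AC) with Σ_{i=1}^N u_i(x,t)² = 1 for all (x,t), and suppose μ₀ᵋ(Q) ≤ D. Let G(s) = σ⁻¹ ∫₀^s √(2W(y)) dy and w_i = G ∘ u_i. Then for each i: (i) ∫_Q |∇w_i(x,t)| dx ≤ μₜ^{i,ε}(Q) ≤ D for every t ∈ [0,T), and (ii) ∫₀^T ∫_Q |∂_t w_i| dx dt ≤ D(1+T). -/

import Mathlib

open MeasureTheory Set Filter
open scoped InnerProductSpace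

noncomputable section

/-- Euclidean space `ℝ^d`. -/
abbrev Euc (d : ℕ) := EuclideanSpace ℝ (Fin d)

/-- The double-well potential `W(s) = s²(1-s)²/2`. -/
def W (s : ℝ) : ℝ := s ^ 2 * (1 - s) ^ 2 / 2

/-- Its derivative `W'(s) = 2s³ - 3s² + s`. -/
def W' (s : ℝ) : ℝ := 2 * s ^ 3 - 3 * s ^ 2 + s

/-- Partial derivative in the `k`-th coordinate direction. -/
def pd (d : ℕ) (k : Fin d) (f : Euc d → ℝ) (x : Euc d) : ℝ :=
  fderiv ℝ f x (EuclideanSpace.single k 1)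

/-- The Laplacian of `f : ℝ^d → ℝ`. -/
def lap (d : ℕ) (f : Euc d → ℝ) (x : Euc d) : ℝ :=
  ∑ k : Fin d, pd d k (fun y => pd d k f y) x

/-- The vector in `ℝ^d` with integer coordinates `v`. -/
def intVec {d : ℕ} (v : Fin d → ℤ) : Euc d :=
  (EuclideanSpace.equiv (Fin d) ℝ).symm (fun k => (v k : ℝ))

/-- A function on `ℝ^d` is `ℤ^d`-periodic if it is invariant under translation by
every integer vector. -/
def ZPeriodic {d : ℕ} {α : Type*} (f : Euc d → α) : Prop :=
  ∀ (x : Euc d) (v : Fin d → ℤ), f (x + intVec v) = f x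

/-- The fundamental domain `Q = [0,1)^d` of the torus. -/
def QCube (d : ℕ) : Set (Euc d) := {x | ∀ k, x k ∈ Ico (0:ℝ) 1}

/-- `σ = ∫₀¹ √(2W(a)) da`. -/
def sigma0 : ℝ := ∫ a in (0:ℝ)..1, Real.sqrt (2 * W a)

/-- A classical solution of the Allen–Cahn system (AC): `ℤ^d`-periodic in `x`, twice
continuously differentiable in `x` and once in `t` (with continuous derivatives), and
satisfying `ε ∂ₜ uᵢ = ε Δuᵢ - W'(uᵢ)/ε + λᵋ uᵢ` on `ℝ^d × (0,T)`, where
`λᵋ = Σⱼ uⱼ (-ε Δuⱼ + W'(uⱼ)/ε)`. -/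
structure IsACSolution (d N : ℕ) (T ε : ℝ) (u : Fin N → ℝ → Euc d → ℝ) : Prop where
  periodic : ∀ i t, ZPeriodic (u i t)
  regx : ∀ i t, ContDiff ℝ 2 (u i t)
  regt : ∀ i x, ContDiffOn ℝ 1 (fun s => u i s x) (Ico 0 T)
  cont_u : ∀ i, ContinuousOn (fun p : ℝ × Euc d => u i p.1 p.2) (Ico 0 T ×ˢ univ)
  cont_dt : ∀ i, ContinuousOn (fun p : ℝ × Euc d => deriv (fun s => u i s p.2) p.1)
    (Ioo 0 T ×ˢ univ)
  cont_grad : ∀ i, ContinuousOn (fun p : ℝ × Euc d => gradient (u i p.1) p.2)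
    (Ico 0 T ×ˢ univ)
  cont_lap : ∀ i, ContinuousOn (fun p : ℝ × Euc d => lap d (u i p.1) p.2)
    (Ico 0 T ×ˢ univ)
  eqn : ∀ i x, ∀ t ∈ Ioo 0 T,
    ε * deriv (fun s => u i s x) t =
      ε * lap d (u i t) x - W' (u i t x) / ε +
        (∑ j, u j t x * (-(ε * lap d (u j t) x) + W' (u j t x) / ε)) * u i t x

/-- `μₜ^{i,ε}(Q) = σ⁻¹ ∫_Q (ε|∇uᵢ|²/2 + W(uᵢ)/ε) dx`. -/
def muI (d : ℕ) (ε : ℝ) (f : ℝ → Euc d → ℝ) (t : ℝ) : ℝ :=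
  sigma0⁻¹ * ∫ x in QCube d, (ε * ‖gradient (f t) x‖ ^ 2 / 2 + W (f t x) / ε)

/-- `μₜᵋ(Q) = Σᵢ μₜ^{i,ε}(Q)`. -/
def muE (d N : ℕ) (ε : ℝ) (u : Fin N → ℝ → Euc d → ℝ) (t : ℝ) : ℝ :=
  ∑ i, muI d ε (u i) t

/-- `G(s) = σ⁻¹ ∫₀^s √(2W(y)) dy`. -/
def Gfun (s : ℝ) : ℝ := sigma0⁻¹ * ∫ y in (0:ℝ)..s, Real.sqrt (2 * W y)

/-- The closed unit cube `[0,1]^d`. -/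
def closedCube (d : ℕ) : Set (Euc d) := {x | ∀ k, x k ∈ Icc (0:ℝ) 1}

lemma closedCube_eq_preimage (d : ℕ) :
    closedCube d = WithLp.ofLp ⁻¹' (Icc (0 : Fin d → ℝ) 1) := by
  ext x
  simp [closedCube, Pi.le_def, forall_and]

lemma isCompact_closedCube (d : ℕ) : IsCompact (closedCube d) := by
  rw [closedCube_eq_preimage]
  exact (EuclideanSpace.equiv (Fin d) ℝ).toHomeomorph.isCompact_preimage.2 isCompact_Icc

lemma restrict_QCube (d : ℕ) :
    (volume : Measure (Euc d)).restrict (QCube d) = volume.restrict (closedCube d) := by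
  apply Measure.restrict_congr_set
  have h2 := (PiLp.volume_preserving_ofLp (Fin d)).quasiMeasurePreserving.preimage_ae_eq
    (Measure.univ_pi_Ico_ae_eq_Icc (f := fun _ : Fin d => (0:ℝ)) (g := fun _ => 1)
      (μ := fun _ => volume))
  rw [closedCube_eq_preimage]
  have hQ : QCube d = WithLp.ofLp ⁻¹' (univ.pi fun _ => Ico (0:ℝ) 1) := by
    ext x
    simp [QCube]
  rw [hQ]
  exact h2

lemma integral_closedCube (d : ℕ) (f : Euc d → ℝ) :
    ∫ x in closedCube d, f x = ∫ y in Icc (0 : Fin d → ℝ) 1, f (WithLp.toLp 2 y) := by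
  rw [closedCube_eq_preimage]
  exact (PiLp.volume_preserving_ofLp (Fin d)).setIntegral_preimage_emb
    (MeasurableEquiv.toLp 2 (Fin d → ℝ)).symm.measurableEmbedding
    (fun y => f (WithLp.toLp 2 y)) (Icc 0 1)

lemma contDiff_pd {d : ℕ} {f : Euc d → ℝ} {n m : WithTop ℕ∞} (hf : ContDiff ℝ n f)
    (hnm : m + 1 ≤ n) (k : Fin d) : ContDiff ℝ m (pd d k f) :=
  (hf.fderiv_right hnm).clm_apply contDiff_const

lemma ZPeriodic.pd {d : ℕ} {f : Euc d → ℝ} (hf : ZPeriodic f) (k : Fin d) :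
    ZPeriodic (pd d k f) := by
  intro x v
  unfold _root_.pd
  rw [← fderiv_comp_add_right]
  simp only [show (fun y => f (y + intVec v)) = f from funext fun y => hf y v]

lemma inner_gradient_eq_sum {d : ℕ} (f g : Euc d → ℝ) (x : Euc d) :
    ⟪gradient f x, gradient g x⟫_ℝ = ∑ k, pd d k f x * pd d k g x := by
  have h : ∀ (f : Euc d → ℝ) k, gradient f x k = pd d k f x := fun f k => by
    rw [pd, ← inner_gradient_left, EuclideanSpace.inner_single_right]
    simp
  simp only [PiLp.inner_apply, h, RCLike.inner_apply, conj_trivial, mul_comm]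

lemma integral_sum_pd_eq_zero {d : ℕ} (F : Fin d → Euc d → ℝ)
    (hF : ∀ k, ContDiff ℝ 1 (F k)) (hp : ∀ k, ZPeriodic (F k)) :
    ∫ x in closedCube d, ∑ k, pd d k (F k) x = 0 := by
  rcases d with _ | n
  · simp
  rw [integral_closedCube]
  set L : (Fin (n + 1) → ℝ) ≃L[ℝ] Euc (n + 1) := (EuclideanSpace.equiv (Fin (n + 1)) ℝ).symm
  have hL : ∀ y, L y = WithLp.toLp 2 y := fun y => rfl
  have key := integral_divergence_of_hasFDerivAt_off_countable' (0 : Fin (n + 1) → ℝ) 1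
    zero_le_one (fun k y => F k (L y))
    (fun k y => (fderiv ℝ (F k) (L y)).comp (L : (Fin (n + 1) → ℝ) →L[ℝ] Euc (n + 1))) ∅
    countable_empty
    (fun k => ((hF k).continuous.comp L.continuous).continuousOn)
    (fun y _ k => ((hF k).differentiable one_ne_zero (L y)).hasFDerivAt.comp y L.hasFDerivAt)
    (by
      refine Continuous.integrableOn_Icc (continuous_finsetSum _ fun k _ => ?_)
      exact ((((hF k).continuous_fderiv one_ne_zero).comp L.continuous).clm_comp
        continuous_const).clm_apply continuous_const)
  refine Eq.trans ?_ (key.trans ?_)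
  · refine setIntegral_congr_fun measurableSet_Icc fun y _ => ?_
    refine Finset.sum_congr rfl fun k _ => ?_
    rfl
  · refine Finset.sum_eq_zero fun k _ => sub_eq_zero.2 ?_
    congr 1
    funext y
    have := hp k (L (Fin.insertNth k 0 y)) (Pi.single k 1)
    simp only [Pi.zero_apply, Pi.one_apply]
    rw [← this]
    congr 1
    ext j
    rcases Fin.eq_self_or_eq_succAbove k j with rfl | ⟨i, rfl⟩
    · simp [hL, intVec]
    · simp [hL, intVec]

lemma integral_inner_gradient {d : ℕ} {a b : Euc d → ℝ} (ha : ContDiff ℝ 2 a)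
    (hb : ContDiff ℝ 2 b) (pa : ZPeriodic a) (pb : ZPeriodic b) :
    ∫ x in closedCube d, ⟪gradient a x, gradient b x⟫_ℝ
      = -∫ x in closedCube d, a x * lap d b x := by
  have h1 : ∀ k, ContDiff ℝ 1 (pd d k b) := fun k => contDiff_pd hb (by norm_num) k
  have h0 : ∀ k, Continuous (pd d k a) := fun k =>
    (contDiff_pd (m := 1) ha (by norm_num) k).continuous
  have h2 : ∀ k, Continuous (pd d k (pd d k b)) := fun k =>
    (contDiff_pd (m := 0) (h1 k) (by norm_num) k).continuous
  have key := integral_sum_pd_eq_zero (fun k x => a x * pd d k b x)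
    (fun k => (ha.of_le one_le_two).mul (h1 k))
    (fun k x v => by simp only [pa x v, pb.pd k x v])
  have hpt : ∀ x, ∑ k, pd d k (fun x => a x * pd d k b x) x
      = ⟪gradient a x, gradient b x⟫_ℝ + a x * lap d b x := fun x => by
    rw [inner_gradient_eq_sum, lap, Finset.mul_sum, ← Finset.sum_add_distrib]
    refine Finset.sum_congr rfl fun k _ => ?_
    have := (((ha.differentiable two_ne_zero) x).hasFDerivAt.fun_mul
      (((h1 k).differentiable one_ne_zero) x).hasFDerivAt).fderiv
    rw [pd, this]
    simp only [add_apply, smul_apply, smul_eq_mul]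
    rw [add_comm, mul_comm (pd d k b x)]
    rfl
  have hlap : Continuous (lap d b) := continuous_finsetSum _ fun k _ => h2 k
  simp only [hpt] at key
  rw [integral_add] at key
  · linarith
  · simp only [inner_gradient_eq_sum]
    exact (continuous_finsetSum _ fun k _ => (h0 k).mul
      (h1 k).continuous).continuousOn.integrableOn_compact (isCompact_closedCube d)
  · exact (ha.continuous.mul hlap).continuousOn.integrableOn_compact (isCompact_closedCube d)

lemma continuous_lap {d : ℕ} {b : Euc d → ℝ} (hb : ContDiff ℝ 2 b) : Continuous (lap d b) :=
  continuous_finsetSum _ fun k _ =>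
    (contDiff_pd (m := 0) (contDiff_pd (m := 1) hb (by norm_num) k) (by norm_num) k).continuous

lemma continuous_gradient {d : ℕ} {b : Euc d → ℝ} (hb : ContDiff ℝ 2 b) :
    Continuous (gradient b) :=
  (InnerProductSpace.toDual ℝ (Euc d)).symm.continuous.comp
    (hb.continuous_fderiv two_ne_zero)

lemma integral_norm_gradient_sq_sub {d : ℕ} {a b : Euc d → ℝ} (ha : ContDiff ℝ 2 a)
    (hb : ContDiff ℝ 2 b) (pa : ZPeriodic a) (pb : ZPeriodic b) :
    (∫ x in closedCube d, ‖gradient a x‖ ^ 2) - ∫ x in closedCube d, ‖gradient b x‖ ^ 2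
      = ∫ x in closedCube d, (a x - b x) * -(lap d a x + lap d b x) := by
  have hint : ∀ {f g : Euc d → ℝ}, ContDiff ℝ 2 f → ContDiff ℝ 2 g →
      IntegrableOn (fun x => f x * lap d g x) (closedCube d) := fun hf hg =>
    (hf.continuous.mul (continuous_lap hg)).continuousOn.integrableOn_compact
      (isCompact_closedCube d)
  have e1 := integral_inner_gradient ha hb pa pb
  have e2 := integral_inner_gradient hb ha pb pa
  have e3 : ∫ x in closedCube d, ⟪gradient a x, gradient b x⟫_ℝ
      = ∫ x in closedCube d, ⟪gradient b x, gradient a x⟫_ℝ := by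
    congr 1
    funext x
    exact real_inner_comm _ _
  simp only [← real_inner_self_eq_norm_sq]
  rw [integral_inner_gradient ha ha pa pa, integral_inner_gradient hb hb pb pb]
  have : ∀ x, (a x - b x) * -(lap d a x + lap d b x)
      = ((b x * lap d b x - a x * lap d a x) - a x * lap d b x) + b x * lap d a x :=
    fun x => by ring
  simp only [this]
  rw [integral_add ?_ (hint hb ha), integral_sub ?_ (hint ha hb),
    integral_sub (hint hb hb) (hint ha ha)]
  · linarith
  · exact (hint hb hb).sub (hint ha ha)
  · exact ((hint hb hb).sub (hint ha ha)).sub (hint ha hb)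

lemma hasDerivAt_of_sub_eq_integral {d : ℕ} {T t₀ : ℝ} {A : ℝ → ℝ} {φ φ' ψ : ℝ → Euc d → ℝ}
    (ht₀ : t₀ ∈ Ioo 0 T)
    (hφ : ∀ x, ∀ t ∈ Ioo 0 T, HasDerivAt (fun s => φ s x) (φ' t x) t)
    (hφc : ∀ t ∈ Ioo 0 T, Continuous (φ t))
    (hφ' : ContinuousOn (fun p : ℝ × Euc d => φ' p.1 p.2) (Ioo 0 T ×ˢ univ))
    (hψ : ContinuousOn (fun p : ℝ × Euc d => ψ p.1 p.2) (Ioo 0 T ×ˢ univ))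
    (hA : ∀ t ∈ Ioo 0 T, A t - A t₀ = ∫ x in closedCube d, (φ t x - φ t₀ x) * ψ t x) :
    HasDerivAt A (∫ x in closedCube d, φ' t₀ x * ψ t₀ x) t₀ := by
  obtain ⟨r, hr, hball⟩ := Metric.nhds_basis_closedBall.mem_iff.1 (Ioo_mem_nhds ht₀.1 ht₀.2)
  have hsub : Metric.closedBall t₀ r ×ˢ closedCube d ⊆ Ioo 0 T ×ˢ univ :=
    prod_mono hball (subset_univ _)
  have hcpt : IsCompact (Metric.closedBall t₀ r ×ˢ closedCube d) :=
    (isCompact_closedBall t₀ r).prod (isCompact_closedCube d)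
  obtain ⟨M₁, hM₁⟩ := hcpt.exists_bound_of_continuousOn (hφ'.mono hsub)
  obtain ⟨M₂, hM₂⟩ := hcpt.exists_bound_of_continuousOn (hψ.mono hsub)
  have hψx : ∀ t ∈ Ioo 0 T, Continuous (ψ t) := fun t ht =>
    continuousOn_univ.1 (hψ.comp (f := fun x => (t, x)) (by fun_prop) fun x _ => ⟨ht, mem_univ _⟩)
  have hmeas : MeasurableSet (closedCube d) := (isCompact_closedCube d).measurableSet
  have hnear : ∀ᶠ t in nhdsWithin t₀ {t₀}ᶜ, t ∈ Metric.closedBall t₀ r :=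
    nhdsWithin_le_nhds (Metric.closedBall_mem_nhds t₀ hr)
  rw [hasDerivAt_iff_tendsto_slope]
  have hslope : ∀ᶠ t in nhdsWithin t₀ {t₀}ᶜ,
      ∫ x in closedCube d, slope (fun s => φ s x) t₀ t * ψ t x = slope A t₀ t := by
    filter_upwards [hnear] with t ht
    rw [slope_def_field, hA t (hball ht), ← integral_div]
    congr 1
    funext x
    rw [slope_def_field]
    ring
  refine Tendsto.congr' hslope ?_
  refine tendsto_integral_filter_of_dominated_convergence (fun _ => M₁ * M₂) ?_ ?_ ?_ ?_
  · filter_upwards [hnear] with t ht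
    simp only [slope_def_field]
    exact ((((hφc t (hball ht)).sub (hφc t₀ ht₀)).div_const _).mul
      (hψx t (hball ht))).aestronglyMeasurable
  · filter_upwards [hnear, self_mem_nhdsWithin] with t ht hne
    refine (ae_restrict_iff' hmeas).2 (ae_of_all _ fun x hx => ?_)
    rw [norm_mul]
    have hlip := (convex_closedBall t₀ r).norm_image_sub_le_of_norm_hasDerivWithin_le
      (f := fun s => φ s x) (f' := fun s => φ' s x) (C := M₁)
      (fun s hs => (hφ x s (hball hs)).hasDerivWithinAt)
      (fun s hs => hM₁ (s, x) ⟨hs, hx⟩) (Metric.mem_closedBall_self hr.le) ht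
    have hpos : 0 < ‖t - t₀‖ := norm_pos_iff.2 (sub_ne_zero.2 hne)
    refine mul_le_mul ?_ (hM₂ (t, x) ⟨ht, hx⟩) (norm_nonneg _)
      ((norm_nonneg _).trans (hM₁ (t, x) ⟨ht, hx⟩))
    rw [slope_def_field, norm_div, div_le_iff₀ hpos]
    exact hlip
  · exact integrableOn_const (isCompact_closedCube d).measure_lt_top.ne
  · refine ae_of_all _ fun x => Tendsto.mul ?_ ?_
    · exact hasDerivAt_iff_tendsto_slope.1 (hφ x t₀ ht₀)
    · have : ContinuousAt (fun t => ψ t x) t₀ :=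
        (hψ.continuousAt ((isOpen_Ioo.prod isOpen_univ).mem_nhds ⟨ht₀, mem_univ x⟩)).comp
          (f := fun t => (t, x)) (by fun_prop)
      exact this.tendsto.mono_left nhdsWithin_le_nhds

lemma continuous_W : Continuous W := by
  unfold W
  fun_prop

lemma continuous_W' : Continuous W' := by
  unfold W'
  fun_prop

lemma W_nonneg (s : ℝ) : 0 ≤ W s := by
  unfold W
  positivity

lemma hasDerivAt_W (s : ℝ) : HasDerivAt W (W' s) s := by
  have h := (((hasDerivAt_id s).pow 2).mul (((hasDerivAt_id s).const_sub 1).pow 2)).div_const 2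
  refine HasDerivAt.congr_deriv h ?_
  simp only [W', id, Pi.pow_apply]
  ring

lemma sigma0_nonneg : 0 ≤ sigma0 :=
  intervalIntegral.integral_nonneg zero_le_one fun _ _ => Real.sqrt_nonneg _

lemma hasDerivAt_Gfun (s : ℝ) : HasDerivAt Gfun (sigma0⁻¹ * √(2 * W s)) s := by
  have hc : Continuous fun y => √(2 * W y) := (continuous_const.mul continuous_W).sqrt
  exact (hc.integral_hasStrictDerivAt 0 s).hasDerivAt.const_mul _

/-- The Modica–Mortola inequality for the derivative of `G`. -/
lemma sqrt_mul_le {ε : ℝ} (hε : 0 < ε) (s a : ℝ) :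
    √(2 * W s) * a ≤ ε * a ^ 2 / 2 + W s / ε := by
  have hsq : √(2 * W s) ^ 2 = 2 * W s := Real.sq_sqrt (by linarith [W_nonneg s])
  have hW : W s / ε = (√(2 * W s)) ^ 2 / (2 * ε) := by
    rw [hsq]
    field_simp
  have : ε * a ^ 2 / 2 + W s / ε - √(2 * W s) * a = (ε * a - √(2 * W s)) ^ 2 / (2 * ε) := by
    rw [hW]
    field_simp
    ring
  have h0 : 0 ≤ (ε * a - √(2 * W s)) ^ 2 / (2 * ε) := by positivity
  linarith

lemma norm_gradient_Gfun_comp {d : ℕ} {f : Euc d → ℝ} {x : Euc d}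
    (hf : DifferentiableAt ℝ f x) :
    ‖gradient (fun y => Gfun (f y)) x‖ = sigma0⁻¹ * (√(2 * W (f x)) * ‖gradient f x‖) := by
  have h := (hasDerivAt_Gfun (f x)).comp_hasFDerivAt x hf.hasFDerivAt
  have h' : fderiv ℝ (fun y => Gfun (f y)) x = _ := h.fderiv
  simp only [gradient, LinearIsometryEquiv.norm_map]
  rw [h', norm_smul, Real.norm_of_nonneg
    (mul_nonneg (inv_nonneg.2 sigma0_nonneg) (Real.sqrt_nonneg _)), mul_assoc]

lemma abs_deriv_Gfun_comp {f : ℝ → ℝ} {t : ℝ} (hf : DifferentiableAt ℝ f t) :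
    |deriv (fun s => Gfun (f s)) t| = sigma0⁻¹ * (√(2 * W (f t)) * |deriv f t|) := by
  have h' : deriv (fun s => Gfun (f s)) t = _ :=
    ((hasDerivAt_Gfun (f t)).comp t hf.hasDerivAt).deriv
  rw [h', abs_mul, abs_of_nonneg
    (mul_nonneg (inv_nonneg.2 sigma0_nonneg) (Real.sqrt_nonneg _)), mul_assoc]

lemma Continuous.integrableOn_closedCube {d : ℕ} {f : Euc d → ℝ} (hf : Continuous f) :
    IntegrableOn f (closedCube d) :=
  hf.continuousOn.integrableOn_compact (isCompact_closedCube d)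

lemma muI_eq {d : ℕ} {ε : ℝ} {f : ℝ → Euc d → ℝ} {t : ℝ} (hf : ContDiff ℝ 2 (f t)) :
    muI d ε f t = sigma0⁻¹ * (ε / 2 * (∫ x in closedCube d, ‖gradient (f t) x‖ ^ 2)
      + ε⁻¹ * ∫ x in closedCube d, W (f t x)) := by
  rw [muI, restrict_QCube, ← integral_const_mul (ε / 2), ← integral_const_mul ε⁻¹, ← integral_add]
  · congr 2
    funext x
    ring
  · exact (continuous_const.mul ((continuous_gradient hf).norm.pow 2)).integrableOn_closedCube
  · exact (continuous_const.mul (continuous_W.comp hf.continuous)).integrableOn_closedCube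

lemma muI_nonneg (d : ℕ) {ε : ℝ} (hε : 0 < ε) (f : ℝ → Euc d → ℝ) (t : ℝ) :
    0 ≤ muI d ε f t := by
  refine mul_nonneg (inv_nonneg.2 sigma0_nonneg) (integral_nonneg fun x => ?_)
  have := W_nonneg (f t x)
  positivity

lemma integral_norm_gradient_Gfun_le_muI {d : ℕ} {ε : ℝ} (hε : 0 < ε) {f : ℝ → Euc d → ℝ}
    {t : ℝ} (hf : ContDiff ℝ 2 (f t)) :
    ∫ x in QCube d, ‖gradient (fun y => Gfun (f t y)) x‖ ≤ muI d ε f t := by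
  have hg := (continuous_gradient hf).norm
  have hW := continuous_W.comp hf.continuous
  simp only [norm_gradient_Gfun_comp (hf.differentiable two_ne_zero _)]
  rw [integral_const_mul, muI, restrict_QCube]
  refine mul_le_mul_of_nonneg_left ?_ (inv_nonneg.2 sigma0_nonneg)
  refine integral_mono (((continuous_const.mul hW).sqrt.mul hg).integrableOn_closedCube)
    (Continuous.integrableOn_closedCube ?_) fun x => sqrt_mul_le hε _ _
  exact ((continuous_const.mul (hg.pow 2)).div_const _).add (hW.div_const _)

namespace IsACSolution

variable {d N : ℕ} {T ε : ℝ} {u : Fin N → ℝ → Euc d → ℝ}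

lemma differentiableAt_time (hu : IsACSolution d N T ε u) (i : Fin N) (x : Euc d) {t : ℝ}
    (ht : t ∈ Ioo 0 T) : DifferentiableAt ℝ (fun s => u i s x) t :=
  ((hu.regt i x).differentiableOn one_ne_zero).differentiableAt (Ico_mem_nhds ht.1 ht.2)

lemma continuous_deriv_time (hu : IsACSolution d N T ε u) (i : Fin N) {t : ℝ}
    (ht : t ∈ Ioo 0 T) : Continuous fun x => deriv (fun s => u i s x) t :=
  continuousOn_univ.1 ((hu.cont_dt i).comp (f := fun x => (t, x)) (by fun_prop)
    fun x _ => ⟨ht, mem_univ _⟩)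

lemma continuousOn_muI (hu : IsACSolution d N T ε u) (i : Fin N) {b : ℝ} (hb : b < T) :
    ContinuousOn (muI d ε (u i)) (Icc 0 b) := by
  have hsub : (Icc 0 b ×ˢ univ : Set (ℝ × Euc d)) ⊆ Ico 0 T ×ˢ univ :=
    prod_mono (Icc_subset_Ico_right hb) subset_rfl
  have hc : ContinuousOn (fun p : ℝ × Euc d =>
      ε * ‖gradient (u i p.1) p.2‖ ^ 2 / 2 + W (u i p.1 p.2) / ε) (Icc 0 b ×ˢ univ) :=
    ((continuousOn_const.mul (((hu.cont_grad i).mono hsub).norm.pow 2)).div_const _).add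
      ((continuous_W.comp_continuousOn ((hu.cont_u i).mono hsub)).div_const _)
  rw [continuousOn_iff_continuous_domRestrict]
  have h := continuous_parametric_integral_of_continuous (μ := (volume : Measure (Euc d)))
    (X := Icc (0:ℝ) b) (f := fun t x =>
      ε * ‖gradient (u i t) x‖ ^ 2 / 2 + W (u i t x) / ε)
    (hc.comp_continuous (f := fun p : Icc (0:ℝ) b × Euc d => ((p.1 : ℝ), p.2)) (by fun_prop)
      fun p => ⟨p.1.2, mem_univ _⟩) (isCompact_closedCube d)
  refine (h.const_mul sigma0⁻¹).congr fun t => ?_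
  simp only [Set.domRestrict_apply, muI, restrict_QCube]

lemma hasDerivAt_muI (hu : IsACSolution d N T ε u) (i : Fin N) {t : ℝ} (ht : t ∈ Ioo 0 T) :
    HasDerivAt (muI d ε (u i)) (-(sigma0⁻¹ * ∫ x in closedCube d,
      deriv (fun s => u i s x) t * (ε * lap d (u i t) x - W' (u i t x) / ε))) t := by
  have hsub : (Ioo 0 T ×ˢ univ : Set (ℝ × Euc d)) ⊆ Ico 0 T ×ˢ univ :=
    prod_mono Ioo_subset_Ico_self subset_rfl
  have hdt := hu.continuous_deriv_time i ht
  have hlap := continuous_lap (hu.regx i t)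
  have h1 := hasDerivAt_of_sub_eq_integral (d := d) (T := T)
    (A := fun t => ∫ x in closedCube d, ‖gradient (u i t) x‖ ^ 2) (φ := u i)
    (φ' := fun t x => deriv (fun s => u i s x) t)
    (ψ := fun s x => -(lap d (u i s) x + lap d (u i t) x)) ht
    (fun x t ht => (hu.differentiableAt_time i x ht).hasDerivAt)
    (fun t _ => (hu.regx i t).continuous) (hu.cont_dt i)
    (((hu.cont_lap i).mono hsub).add (hlap.comp continuous_snd).continuousOn).neg
    (fun s _ => integral_norm_gradient_sq_sub (hu.regx i s) (hu.regx i t)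
      (hu.periodic i s) (hu.periodic i t))
  have hWint : ∀ t, IntegrableOn (fun x => W (u i t x)) (closedCube d) := fun t =>
    (continuous_W.comp (hu.regx i t).continuous).integrableOn_closedCube
  have h2 := hasDerivAt_of_sub_eq_integral (d := d) (T := T)
    (A := fun t => ∫ x in closedCube d, W (u i t x)) (φ := fun t x => W (u i t x))
    (φ' := fun t x => W' (u i t x) * deriv (fun s => u i s x) t)
    (ψ := fun _ _ => 1) ht
    (fun x t ht => (hasDerivAt_W _).comp t (hu.differentiableAt_time i x ht).hasDerivAt)
    (fun t _ => continuous_W.comp (hu.regx i t).continuous)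
    ((continuous_W'.comp_continuousOn ((hu.cont_u i).mono hsub)).mul (hu.cont_dt i))
    continuousOn_const
    (fun s _ => by simp only [mul_one]; exact (integral_sub (hWint s) (hWint t)).symm)
  have h := ((h1.const_mul (ε / 2)).add (h2.const_mul ε⁻¹)).const_mul sigma0⁻¹
  have heq : muI d ε (u i) = _ := funext fun s => muI_eq (hu.regx i s)
  rw [heq]
  refine HasDerivAt.congr_deriv h ?_
  rw [← integral_const_mul (ε / 2), ← integral_const_mul ε⁻¹, ← integral_add, ← mul_neg, ← integral_neg]
  · congr 2
    funext x
    ring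
  · exact (continuous_const.mul (hdt.mul (hlap.add hlap).neg)).integrableOn_closedCube
  · exact (continuous_const.mul (((continuous_W'.comp (hu.regx i t).continuous).mul hdt).mul
      continuous_const)).integrableOn_closedCube

lemma sum_mul_deriv_eq_zero (hu : IsACSolution d N T ε u)
    (hsph : ∀ x, ∀ t ∈ Ico 0 T, ∑ i, (u i t x) ^ 2 = 1) {t : ℝ} (ht : t ∈ Ioo 0 T) (x : Euc d) :
    ∑ i, u i t x * deriv (fun s => u i s x) t = 0 := by
  have h := HasDerivAt.fun_sum (u := Finset.univ) fun i _ =>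
    (hu.differentiableAt_time i x ht).hasDerivAt.fun_pow 2
  have h' : HasDerivAt (fun s => ∑ i, u i s x ^ 2) 0 t := by
    refine (hasDerivAt_const t (1:ℝ)).congr_of_eventuallyEq ?_
    filter_upwards [Ico_mem_nhds ht.1 ht.2] with s hs using hsph x s hs
  have := h.unique h'
  simp only [Nat.cast_ofNat, Nat.add_one_sub_one, pow_one, mul_assoc, ← Finset.mul_sum] at this
  linarith

/-- Energy dissipation identity. -/
lemma hasDerivAt_muE (hu : IsACSolution d N T ε u)
    (hsph : ∀ x, ∀ t ∈ Ico 0 T, ∑ i, (u i t x) ^ 2 = 1) {t : ℝ} (ht : t ∈ Ioo 0 T) :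
    HasDerivAt (muE d N ε u)
      (-(sigma0⁻¹ * ∫ x in closedCube d, ∑ i, ε * deriv (fun s => u i s x) t ^ 2)) t := by
  have h := HasDerivAt.fun_sum (u := Finset.univ) fun i _ => hu.hasDerivAt_muI i ht
  refine HasDerivAt.congr_deriv h ?_
  rw [Finset.sum_neg_distrib, ← Finset.mul_sum, ← integral_finsetSum]
  · congr 3
    funext x
    have hz := hu.sum_mul_deriv_eq_zero hsph ht x
    set l := ∑ j, u j t x * (-(ε * lap d (u j t) x) + W' (u j t x) / ε) with hl
    have e : ∀ i, ε * deriv (fun s => u i s x) t ^ 2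
        = deriv (fun s => u i s x) t * (ε * lap d (u i t) x - W' (u i t x) / ε)
          + l * (u i t x * deriv (fun s => u i s x) t) := fun i => by
      linear_combination deriv (fun s => u i s x) t * hu.eqn i x t ht
    simp only [e, Finset.sum_add_distrib, ← Finset.mul_sum, hz, mul_zero, add_zero]
  · intro i _
    exact ((hu.continuous_deriv_time i ht).mul ((continuous_const.mul
      (continuous_lap (hu.regx i t))).sub ((continuous_W'.comp
        (hu.regx i t).continuous).div_const _))).integrableOn_closedCube

lemma continuousOn_muE (hu : IsACSolution d N T ε u) {b : ℝ} (hb : b < T) :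
    ContinuousOn (muE d N ε u) (Icc 0 b) :=
  continuousOn_finsetSum _ fun i _ => hu.continuousOn_muI i hb

lemma muE_le_muE_zero (hu : IsACSolution d N T ε u) (hε : 0 < ε)
    (hsph : ∀ x, ∀ t ∈ Ico 0 T, ∑ i, (u i t x) ^ 2 = 1) {t : ℝ} (ht : t ∈ Ico 0 T) :
    muE d N ε u t ≤ muE d N ε u 0 := by
  have hanti : AntitoneOn (muE d N ε u) (Icc 0 t) := by
    refine antitoneOn_of_hasDerivWithinAt_nonpos (f' := fun s =>
      -(sigma0⁻¹ * ∫ x in closedCube d, ∑ i, ε * deriv (fun r => u i r x) s ^ 2)) (convex_Icc 0 t) (hu.continuousOn_muE ht.2)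
      (fun s hs => ?_) (fun s _ => ?_)
    · rw [interior_Icc] at hs ⊢
      exact (hu.hasDerivAt_muE hsph ⟨hs.1, hs.2.trans ht.2⟩).hasDerivWithinAt
    · exact neg_nonpos.2 (mul_nonneg (inv_nonneg.2 sigma0_nonneg)
        (integral_nonneg fun x => Finset.sum_nonneg fun i _ => by positivity))
  exact hanti (left_mem_Icc.2 ht.1) (right_mem_Icc.2 ht.1) ht.1

/-- Pointwise-in-time bound for the time variation of `G ∘ uᵢ`. -/
lemma integral_abs_deriv_Gfun_le (hu : IsACSolution d N T ε u) (hε : 0 < ε) (i : Fin N) {t : ℝ}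
    (ht : t ∈ Ioo 0 T) :
    ∫ x in QCube d, |deriv (fun s => Gfun (u i s x)) t| ≤ muI d ε (u i) t +
      sigma0⁻¹ * (∫ x in closedCube d, ∑ j, ε * deriv (fun s => u j s x) t ^ 2) / 2 := by
  have hdt := fun j => hu.continuous_deriv_time j ht
  have hW := continuous_W.comp (hu.regx i t).continuous
  have hg := (continuous_gradient (hu.regx i t)).norm
  have hS : Continuous fun x => ∑ j, ε * deriv (fun s => u j s x) t ^ 2 :=
    continuous_finsetSum _ fun j _ => continuous_const.mul ((hdt j).pow 2)
  have hM : Continuous fun x => ε * ‖gradient (u i t) x‖ ^ 2 / 2 + W (u i t x) / ε :=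
    ((continuous_const.mul (hg.pow 2)).div_const _).add (hW.div_const _)
  simp only [abs_deriv_Gfun_comp (hu.differentiableAt_time i _ ht)]
  rw [integral_const_mul, muI, restrict_QCube, mul_div_assoc, ← mul_add, ← integral_div,
    ← integral_add hM.integrableOn_closedCube (hS.div_const 2).integrableOn_closedCube]
  refine mul_le_mul_of_nonneg_left ?_ (inv_nonneg.2 sigma0_nonneg)
  refine integral_mono (((continuous_const.mul hW).sqrt.mul (hdt i).abs).integrableOn_closedCube)
    (hM.add (hS.div_const 2)).integrableOn_closedCube fun x => ?_
  have h1 := sqrt_mul_le hε (u i t x) |deriv (fun s => u i s x) t|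
  have h2 : ε * deriv (fun s => u i s x) t ^ 2 ≤ ∑ j, ε * deriv (fun s => u j s x) t ^ 2 :=
    Finset.single_le_sum (f := fun j => ε * deriv (fun s => u j s x) t ^ 2)
      (fun j _ => by positivity) (Finset.mem_univ i)
  have h3 : 0 ≤ ε * ‖gradient (u i t) x‖ ^ 2 / 2 := by positivity
  rw [sq_abs] at h1
  simp only
  linarith

end IsACSolution

/-- For a classical solution of (AC) with `Σᵢ uᵢ² ≡ 1` and
`μ₀ᵋ(Q) ≤ D`, and `wᵢ = G ∘ uᵢ`:
(i) `∫_Q |∇wᵢ(·,t)| dx ≤ μₜ^{i,ε}(Q) ≤ D` for every `t ∈ [0,T)`, and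
(ii) `∫₀^T ∫_Q |∂ₜwᵢ| dx dt ≤ D(1+T)`. -/
theorem BV_estimates_for_composed_solution
    {d N : ℕ} (hd : 2 ≤ d) (hN : 2 ≤ N) {T ε : ℝ} (hT : 0 < T) (hε : ε ∈ Ioo (0:ℝ) 1)
    {D : ℝ} (hD : 0 < D)
    (u : Fin N → ℝ → Euc d → ℝ) (hu : IsACSolution d N T ε u)
    (hsph : ∀ x, ∀ t ∈ Ico 0 T, ∑ i, (u i t x) ^ 2 = 1)
    (hinit : muE d N ε u 0 ≤ D) :
    ∀ i,
      (∀ t ∈ Ico 0 T,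
        (∫ x in QCube d, ‖gradient (fun y => Gfun (u i t y)) x‖) ≤ muI d ε (u i) t ∧
          muI d ε (u i) t ≤ D) ∧
      (∫ t in (0:ℝ)..T, ∫ x in QCube d, |deriv (fun s => Gfun (u i s x)) t|) ≤ D * (1 + T) := by
  have hε0 : 0 < ε := hε.1
  have hle : ∀ i t, muI d ε (u i) t ≤ muE d N ε u t := fun i t =>
    Finset.single_le_sum (f := fun i => muI d ε (u i) t)
      (fun j _ => muI_nonneg d hε0 (u j) t) (Finset.mem_univ i)
  have hED : ∀ t ∈ Ico 0 T, muE d N ε u t ≤ D := fun t ht =>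
    (hu.muE_le_muE_zero hε0 hsph ht).trans hinit
  refine fun i => ⟨fun t ht => ⟨integral_norm_gradient_Gfun_le_muI hε0 (hu.regx i t),
    (hle i t).trans (hED t ht)⟩, ?_⟩
  set F : ℝ → ℝ := fun t => ∫ x in QCube d, |deriv (fun s => Gfun (u i s x)) t|
  by_cases hF : IntervalIntegrable F volume 0 T
  swap
  · rw [intervalIntegral.integral_undef hF]
    positivity
  have hFI : IntegrableOn F (Icc 0 T) := (intervalIntegrable_iff_integrableOn_Icc_of_le hT.le).1 hF
  have hb : ∀ b ∈ Ico 0 T, ∫ t in (0:ℝ)..b, F t ≤ D * (1 + T) := fun b hb => by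
    have h := intervalIntegral.integral_le_sub_of_hasDeriv_right_of_le hb.1
      (g := fun t => D * t - muE d N ε u t / 2)
      (g' := fun t => D * 1 - -(sigma0⁻¹ * ∫ x in closedCube d,
        ∑ i, ε * deriv (fun s => u i s x) t ^ 2) / 2) (φ := F)
      ((continuousOn_const.mul continuousOn_id).sub ((hu.continuousOn_muE hb.2).div_const 2))
      (fun t ht => (((hasDerivAt_id t).const_mul D).sub ((hu.hasDerivAt_muE hsph
        ⟨ht.1, ht.2.trans hb.2⟩).div_const 2)).hasDerivWithinAt)
      (hFI.mono_set (Icc_subset_Icc_right hb.2.le))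
      (fun t ht => by
        have ht' : t ∈ Ioo 0 T := ⟨ht.1, ht.2.trans hb.2⟩
        have h1 := hu.integral_abs_deriv_Gfun_le hε0 i ht'
        have h2 := (hle i t).trans (hED t (Ioo_subset_Ico_self ht'))
        simp only [F]
        linarith)
    have h0 : 0 ≤ muE d N ε u b := Finset.sum_nonneg fun j _ => muI_nonneg d hε0 (u j) b
    have hDb : D * b ≤ D * T := mul_le_mul_of_nonneg_left hb.2.le hD.le
    linarith
  have hcont : ContinuousOn (fun b => ∫ t in (0:ℝ)..b, F t) (Icc 0 T) := by
    rw [← uIcc_of_le hT.le] at hFI ⊢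
    exact intervalIntegral.continuousOn_primitive_interval hFI
  have hlim : Tendsto (fun b => ∫ t in (0:ℝ)..b, F t) (nhdsWithin T (Ico 0 T))
      (nhds (∫ t in (0:ℝ)..T, F t)) :=
    (hcont T (right_mem_Icc.2 hT.le)).mono_left (nhdsWithin_mono T Ico_subset_Icc_self)
  have : (nhdsWithin T (Ico 0 T)).NeBot := by
    rw [← mem_closure_iff_nhdsWithin_neBot, closure_Ico hT.ne]
    exact right_mem_Icc.2 hT.le
  exact le_of_tendsto hlim (eventually_mem_nhdsWithin.mono hb)
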